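/- For all n ≥ 2, there is no 1-resilient lock-free strongly linearizable implementation of a counter in an asynchronous message-passing system of n processes. -/

import Mathlib

/-!
A model of asynchronous message-passing systems with `n` processes, following
Fischer–Lynch–Paterson: in a step `(p, m)` process `p` receives message `m`
(`none` if no message), changes its local state, and sends a finite set of messages.
Object implementations encode invocations and responses of operations as changes
of the state of the invoking process.
-/

namespace MP

/-- A step `(p, m)`: process `p` takes a step in which it attempts to receive a
message; it receives `m`, where `m = none` means it receives no message. -/
abbrev Step (n : ℕ) (Msg : Type) : Type := Fin n × Option Msg

/-- An operation event: the invocation of an operation `o`, or the response of `o`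
with return value `v`. -/
inductive Event (Op Val : Type) : Type
  | inv (o : Op)
  | res (o : Op) (v : Val)
deriving DecidableEq

/-- The operation an event belongs to. -/
def Event.opOf {Op Val : Type} : Event Op Val → Op
  | .inv o => o
  | .res o _ => o

/-- A (deterministic) message-passing implementation for `n` processes, of an object
with operations `Op` returning values in `Val`.  In each step a process receives at
most one message, changes its local state via `trans`, and sends a finite list of
messages; invocations and responses of operations are encoded (via `eventOf`) as
changes of the state of the invoking process.  `procOf o` is the process that may
invoke operation `o`. -/
structure Impl (n : ℕ) (Op Val : Type) : Type 1 where
  Msg : Type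
  PState : Type
  init : Fin n → PState
  trans : Fin n → PState → Option Msg → PState × List (Fin n × Msg)
  eventOf : Fin n → PState → PState → Option (Event Op Val)
  procOf : Op → Fin n

variable {n : ℕ} {Op Val : Type}

/-- A configuration: the local states of all processes together with the message
buffer (the multiset of all messages sent but not yet received, tagged with their
destination process). -/
structure Config (I : Impl n Op Val) : Type where
  states : Fin n → I.PState
  buffer : Multiset (Fin n × I.Msg)

/-- The initial configuration: all processes in their initial states, empty buffer. -/
def initConfig (I : Impl n Op Val) : Config I :=
  ⟨I.init, 0⟩

/-- A step `(p, some m)` is applicable to `C` iff `m` is in the buffer for `p`;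
a step `(p, none)` is always applicable. -/
def Applicable (I : Impl n Op Val) (C : Config I) (e : Step n I.Msg) : Prop :=
  match e.2 with
  | none => True
  | some m => (e.1, m) ∈ C.buffer

open scoped Classical in
/-- The configuration resulting from applying step `e` to configuration `C`:
the stepping process changes state, the received message (if any) is removed from
the buffer, and the sent messages are added to it. -/
noncomputable def applyStep (I : Impl n Op Val) (C : Config I) (e : Step n I.Msg) :
    Config I :=
  { states := Function.update C.states e.1 (I.trans e.1 (C.states e.1) e.2).1
    buffer :=
      (match e.2 with
        | none => C.buffer
        | some m => C.buffer.erase (e.1, m))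
      + ((I.trans e.1 (C.states e.1) e.2).2 : Multiset (Fin n × I.Msg)) }

/-- A finite history (sequence of steps) `H` is applicable to `C` if each of its
steps is applicable in turn. -/
def ApplicableHist (I : Impl n Op Val) : Config I → List (Step n I.Msg) → Prop
  | _, [] => True
  | C, e :: H => Applicable I C e ∧ ApplicableHist I (applyStep I C e) H

/-- `H(C)`: the configuration obtained by applying the finite history `H` to `C`. -/
noncomputable def applyHist (I : Impl n Op Val) : Config I → List (Step n I.Msg) → Config I
  | C, [] => C
  | C, e :: H => applyHist I (applyStep I C e) H

/-- The event (if any) encoded by the state change of the process taking step `e`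
from configuration `C`. -/
noncomputable def stepEvent (I : Impl n Op Val) (C : Config I) (e : Step n I.Msg) :
    Option (Event Op Val) :=
  I.eventOf e.1 (C.states e.1) ((applyStep I C e).states e.1)

/-- The operation-level history (sequence of invocation/response events) of the run
in which `H` is applied to `C`. -/
noncomputable def runEvents (I : Impl n Op Val) :
    Config I → List (Step n I.Msg) → List (Event Op Val)
  | _, [] => []
  | C, e :: H => (stepEvent I C e).toList ++ runEvents I (applyStep I C e) H

/-- The set of (finite) histories of implementation `I`: all finite histories
applicable to the initial configuration.  (This set is prefix-closed.) -/
def Histories (I : Impl n Op Val) : Set (List (Step n I.Msg)) :=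
  {H | ApplicableHist I (initConfig I) H}

/-- The operation-level events of a history `H` of `I`. -/
noncomputable def events (I : Impl n Op Val) (H : List (Step n I.Msg)) :
    List (Event Op Val) :=
  runEvents I (initConfig I) H

/-- Operation `o` has been invoked in the event history `L`. -/
def Invoked (o : Op) (L : List (Event Op Val)) : Prop := Event.inv o ∈ L

/-- Operation `o` is complete in the event history `L`: `L` contains both its
invocation and a response for it. -/
def Completed (o : Op) (L : List (Event Op Val)) : Prop :=
  Event.inv o ∈ L ∧ ∃ v, Event.res o v ∈ L

/-- Operation `o` is pending in `L`: invoked but with no response. -/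
def Pending (o : Op) (L : List (Event Op Val)) : Prop :=
  Event.inv o ∈ L ∧ ∀ v, Event.res o v ∉ L

/-- `o` precedes `o'` in `L`: a response of `o` occurs (strictly) before the
invocation of `o'`. -/
def Precedes (L : List (Event Op Val)) (o o' : Op) : Prop :=
  ∃ (i j : ℕ) (hi : i < L.length) (hj : j < L.length),
    i < j ∧ (∃ v, L.get ⟨i, hi⟩ = Event.res o v) ∧ L.get ⟨j, hj⟩ = Event.inv o'

/-- A sequential event history: invocations immediately followed by their matching
responses, possibly ending with a single pending invocation (no two operations are
concurrent). -/
def Sequential : List (Event Op Val) → Prop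
  | [] => True
  | [Event.inv _] => True
  | Event.inv o :: Event.res o' _ :: L => o = o' ∧ Sequential L
  | _ => False

/-- `x` occurs at most once in the list `L`. -/
def AtMostOnce {β : Type _} (x : β) (L : List β) : Prop :=
  ∀ (i j : ℕ) (hi : i < L.length) (hj : j < L.length),
    L.get ⟨i, hi⟩ = x → L.get ⟨j, hj⟩ = x → i = j

/-- Operation `o` has at most one response event in `L`. -/
def AtMostOneRes (o : Op) (L : List (Event Op Val)) : Prop :=
  ∀ (i j : ℕ) (hi : i < L.length) (hj : j < L.length) (v v' : Val),
    L.get ⟨i, hi⟩ = Event.res o v → L.get ⟨j, hj⟩ = Event.res o v' → i = j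

/-- Well-formedness of an implementation: in every history, each operation is
invoked at most once, responds at most once, and responses follow invocations. -/
def WellFormed (I : Impl n Op Val) : Prop :=
  ∀ H ∈ Histories I,
    (∀ o : Op, AtMostOnce (Event.inv o) (events I H)) ∧
    (∀ o : Op, AtMostOneRes o (events I H)) ∧
    (∀ (o : Op) (v : Val), Event.res o v ∈ events I H → Event.inv o ∈ events I H)

/-- `L'` is a completion of the event history `L`: the events of a subset (`removed`)
of the pending operations of `L` are removed, and the remaining pending operations
are completed by appending responses `R` for them. -/
def IsCompletion (L L' : List (Event Op Val)) : Prop :=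
  ∃ (removed : Op → Bool) (R : List (Event Op Val)),
    (∀ o, removed o = true → Pending o L) ∧
    (∀ ev ∈ R, ∃ (o : Op) (v : Val), ev = Event.res o v ∧ Pending o L ∧ removed o = false) ∧
    (∀ o : Op, Pending o L → removed o = false → ∃ v, Event.res o v ∈ R) ∧
    (R.map Event.opOf).Nodup ∧
    L' = L.filter (fun ev => !removed ev.opOf) ++ R

/-- `f` is a linearization function for (the set of histories of) `I` with respect to
the sequential specification `Spec`: it maps each history `H` of `I` to a sequential
history `f H` that (1) has exactly the same operations (with the same responses) as
some completion of the events of `H`, (2) respects precedence, and (3) conforms to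
`Spec`. -/
def IsLinearizationFn (I : Impl n Op Val) (Spec : List (Event Op Val) → Prop)
    (f : List (Step n I.Msg) → List (Event Op Val)) : Prop :=
  ∀ H ∈ Histories I,
    Sequential (f H) ∧
    (∃ L', IsCompletion (events I H) L' ∧
      (∀ ev : Event Op Val, ev ∈ f H ↔ ev ∈ L') ∧
      (∀ o o' : Op, Precedes L' o o' → Precedes (f H) o o')) ∧
    Spec (f H)

/-- `I` is linearizable with respect to the sequential specification `Spec`. -/
def Linearizable (I : Impl n Op Val) (Spec : List (Event Op Val) → Prop) : Prop :=
  ∃ f, IsLinearizationFn I Spec f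

/-- `I` is strongly linearizable: there is a linearization function mapping
prefixes of histories to prefixes of their linearizations. -/
def StronglyLinearizable (I : Impl n Op Val) (Spec : List (Event Op Val) → Prop) : Prop :=
  ∃ f, IsLinearizationFn I Spec f ∧
    ∀ G H, G ∈ Histories I → H ∈ Histories I → G <+: H → f G <+: f H

/-- The finite history consisting of the first `k` steps of an infinite history `S`. -/
def prefixSteps {β : Type _} (S : ℕ → β) (k : ℕ) : List β :=
  (List.range k).map S

/-- The infinite history `S` is applicable to `C`: every step is applicable to the
configuration reached by the preceding steps. -/
def InfApplicable (I : Impl n Op Val) (C : Config I) (S : ℕ → Step n I.Msg) : Prop :=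
  ∀ k, Applicable I (applyHist I C (prefixSteps S k)) (S k)

/-- Process `p` is correct in the infinite history `S`: it takes infinitely many steps. -/
def CorrectProc {Msg : Type} (p : Fin n) (S : ℕ → Step n Msg) : Prop :=
  ∀ k, ∃ k' ≥ k, (S k').1 = p

/-- At most one process crashes (i.e., takes only finitely many steps) in `S`. -/
def AtMostOneCrash {Msg : Type} (S : ℕ → Step n Msg) : Prop :=
  ∀ p q : Fin n, ¬ CorrectProc p S → ¬ CorrectProc q S → p = q

/-- Every message sent to a correct process is eventually received. -/
def FairDelivery (I : Impl n Op Val) (C : Config I) (S : ℕ → Step n I.Msg) : Prop :=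
  ∀ (k : ℕ) (p : Fin n) (m : I.Msg), CorrectProc p S →
    (p, m) ∈ (applyHist I C (prefixSteps S k)).buffer →
    ∃ k' ≥ k, S k' = (p, some m)

/-- `I` is 1-resilient lock-free: for every reachable configuration (reached by a
history `H₀`) with a pending operation by process `p`, and every infinite history
applicable to it in which at most one process crashes, `p` is correct, and every
message sent to a correct process is eventually received, some finite prefix
completes an operation not yet complete. -/
def OneResilientLockFree (I : Impl n Op Val) : Prop :=
  ∀ H₀ ∈ Histories I, ∀ (p : Fin n) (o : Op),
    I.procOf o = p → Pending o (events I H₀) →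
    ∀ S : ℕ → Step n I.Msg,
      InfApplicable I (applyHist I (initConfig I) H₀) S →
      AtMostOneCrash S → CorrectProc p S →
      FairDelivery I (applyHist I (initConfig I) H₀) S →
      ∃ (k : ℕ) (o' : Op),
        Completed o' (events I (H₀ ++ prefixSteps S k)) ∧ ¬ Completed o' (events I H₀)

end MP

namespace MP

/-- The operations of a counter: increment and read. -/
inductive CtrOp : Type
  | inc
  | read
deriving DecidableEq

/-- Sequential specification of a counter with initial value 0: every read returns
the number of increment operations that occur before it. -/
def CtrSpec (L : List (Event CtrOp ℕ)) : Prop :=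
  ∀ (i : ℕ) (hi : i < L.length) (v : ℕ), L.get ⟨i, hi⟩ = Event.res CtrOp.read v →
    v = (L.take i).count (Event.inv CtrOp.inc)

variable {n : ℕ}

/-- The system obtained by using a counter implementation `I` as a Test-or-Set object:
the distinguished process `p0` invokes `read` once (as its first step), and the
distinguished process `p1 ≠ p0` invokes `inc` once (as its first step); the other
processes only help. -/
structure CtrAlg (I : Impl n CtrOp ℕ) (p0 p1 : Fin n) : Prop where
  distinct : p0 ≠ p1
  proc_read : I.procOf CtrOp.read = p0
  proc_inc : I.procOf CtrOp.inc = p1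
  events_own : ∀ (p : Fin n) (s s' : I.PState) (ev : Event CtrOp ℕ),
    I.eventOf p s s' = some ev → I.procOf ev.opOf = p
  wellFormed : WellFormed I
  invokes_read : ∀ m : Option I.Msg,
    I.eventOf p0 (I.init p0) (I.trans p0 (I.init p0) m).1 = some (Event.inv CtrOp.read)
  invokes_inc : ∀ m : Option I.Msg,
    I.eventOf p1 (I.init p1) (I.trans p1 (I.init p1) m).1 = some (Event.inv CtrOp.inc)

end MP

namespace MP

section Runs

variable {n : ℕ} {Op Val : Type} {I : Impl n Op Val}

theorem applyHist_append (C : Config I) (G H : List (Step n I.Msg)) :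
    applyHist I C (G ++ H) = applyHist I (applyHist I C G) H := by
  induction G generalizing C with
  | nil => rfl
  | cons e G ih => exact ih _

theorem applicableHist_append (C : Config I) (G H : List (Step n I.Msg)) :
    ApplicableHist I C (G ++ H) ↔
      ApplicableHist I C G ∧ ApplicableHist I (applyHist I C G) H := by
  induction G generalizing C with
  | nil => simp [ApplicableHist, applyHist]
  | cons e G ih => simp [ApplicableHist, applyHist, ih, and_assoc]

theorem runEvents_append (C : Config I) (G H : List (Step n I.Msg)) :
    runEvents I C (G ++ H) = runEvents I C G ++ runEvents I (applyHist I C G) H := by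
  induction G generalizing C with
  | nil => rfl
  | cons e G ih => simp [runEvents, applyHist, ih]

theorem applicableHist_singleton (C : Config I) (e : Step n I.Msg) :
    ApplicableHist I C [e] ↔ Applicable I C e := by
  simp [ApplicableHist]

theorem mem_histories_append (G H : List (Step n I.Msg)) :
    G ++ H ∈ Histories I ↔
      G ∈ Histories I ∧ ApplicableHist I (applyHist I (initConfig I) G) H :=
  applicableHist_append _ _ _

theorem mem_histories_of_isPrefix {G H : List (Step n I.Msg)} (h : G <+: H)
    (hH : H ∈ Histories I) : G ∈ Histories I := by
  obtain ⟨ρ, rfl⟩ := h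
  exact ((mem_histories_append _ _).1 hH).1

theorem events_append (G H : List (Step n I.Msg)) :
    events I (G ++ H) = events I G ++ runEvents I (applyHist I (initConfig I) G) H :=
  runEvents_append _ _ _

theorem mem_events_append_left {G : List (Step n I.Msg)} (H : List (Step n I.Msg))
    {ev : Event Op Val} (h : ev ∈ events I G) : ev ∈ events I (G ++ H) := by
  rw [events_append]
  exact List.mem_append_left _ h

theorem Completed.append {G : List (Step n I.Msg)} {o : Op} (h : Completed o (events I G))
    (H : List (Step n I.Msg)) : Completed o (events I (G ++ H)) :=
  ⟨mem_events_append_left H h.1, h.2.imp fun _ hv => mem_events_append_left H hv⟩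

theorem pending_or_completed {o : Op} {L : List (Event Op Val)} (h : Event.inv o ∈ L) :
    Pending o L ∨ Completed o L := by
  by_cases hc : ∃ v, Event.res o v ∈ L
  · exact .inr ⟨h, hc⟩
  · exact .inl ⟨h, fun v hv => hc ⟨v, hv⟩⟩

/-- An applicable step stays applicable until it is taken. -/
theorem Applicable.applyStep {C : Config I} {e e' : Step n I.Msg}
    (h : Applicable I C e) (hne : e ≠ e') : Applicable I (applyStep I C e') e := by
  classical
  obtain ⟨p, _ | m⟩ := e
  · trivial
  · obtain ⟨q, _ | m'⟩ := e'
    · exact Multiset.mem_add.2 (.inl h)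
    · refine Multiset.mem_add.2 (.inl ((Multiset.mem_erase_of_ne ?_).2 h))
      rintro heq
      exact hne (by simpa using heq)

theorem Applicable.applyHist {C : Config I} {e : Step n I.Msg} {σ : List (Step n I.Msg)}
    (h : Applicable I C e) (hne : e ∉ σ) : Applicable I (applyHist I C σ) e := by
  induction σ generalizing C with
  | nil => exact h
  | cons e' σ ih =>
    rw [List.mem_cons, not_or] at hne
    exact ih (h.applyStep hne.1) hne.2

/-! ### Commuting steps of different processes -/

theorem applyStep_states_of_ne (C : Config I) {e : Step n I.Msg} {p : Fin n} (h : p ≠ e.1) :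
    (applyStep I C e).states p = C.states p :=
  Function.update_of_ne h _ _

theorem stepEvent_applyStep (C : Config I) {e e' : Step n I.Msg} (h : e.1 ≠ e'.1) :
    stepEvent I (applyStep I C e') e = stepEvent I C e := by
  simp [stepEvent, applyStep, Function.update_of_ne h]

theorem applyStep_comm {C : Config I} {e e' : Step n I.Msg} (h : e.1 ≠ e'.1)
    (he : Applicable I C e) (he' : Applicable I C e') :
    applyStep I (applyStep I C e) e' = applyStep I (applyStep I C e') e := by
  classical
  obtain ⟨p, m⟩ := e
  obtain ⟨q, m'⟩ := e'
  dsimp only at h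
  have hst := Function.update_comm h (I.trans p (C.states p) m).1
    (I.trans q (C.states q) m').1 C.states
  simp only [applyStep, Function.update_of_ne h, Function.update_of_ne h.symm, Config.mk.injEq]
  refine ⟨hst, ?_⟩
  rcases m with _ | m <;> rcases m' with _ | m' <;> dsimp only
  · exact add_right_comm _ _ _
  · rw [Multiset.erase_add_left_pos _ he']
    exact add_right_comm _ _ _
  · rw [Multiset.erase_add_left_pos _ he]
    exact add_right_comm _ _ _
  · have hne : ((p, m) : Fin n × I.Msg) ≠ (q, m') := fun heq => h (congrArg Prod.fst heq)
    rw [Multiset.erase_add_left_pos _ ((Multiset.mem_erase_of_ne hne).2 he),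
      Multiset.erase_add_left_pos _ ((Multiset.mem_erase_of_ne hne.symm).2 he'),
      Multiset.erase_comm]
    exact add_right_comm _ _ _

theorem step_hist_comm {C : Config I} {e : Step n I.Msg} {ρ : List (Step n I.Msg)}
    (h : ∀ x ∈ ρ, x.1 ≠ e.1) (he : Applicable I C e) (hρ : ApplicableHist I C ρ) :
    ApplicableHist I (applyStep I C e) ρ ∧
      applyHist I (applyStep I C e) ρ = applyStep I (applyHist I C ρ) e ∧
      runEvents I (applyStep I C e) ρ = runEvents I C ρ ∧
      stepEvent I (applyHist I C ρ) e = stepEvent I C e := by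
  induction ρ generalizing C with
  | nil => exact ⟨trivial, rfl, rfl, rfl⟩
  | cons x ρ ih =>
    have hx := h x (by simp)
    have hxe : x ≠ e := fun heq => hx (congrArg Prod.fst heq)
    obtain ⟨h1, h2, h3, h4⟩ := ih (fun y hy => h y (by simp [hy]))
      (he.applyStep hxe.symm) hρ.2
    have hc := applyStep_comm hx hρ.1 he
    refine ⟨⟨hρ.1.applyStep hxe, hc ▸ h1⟩, ?_, ?_, ?_⟩
    · simp only [applyHist, ← hc, h2]
    · simp only [runEvents, ← hc, h3, stepEvent_applyStep C hx]
    · simp only [applyHist, h4, stepEvent_applyStep C hx.symm]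

theorem hist_hist_comm {C : Config I} {α ρ : List (Step n I.Msg)}
    (h : ∀ x ∈ ρ, ∀ y ∈ α, x.1 ≠ y.1) (hα : ApplicableHist I C α)
    (hρ : ApplicableHist I C ρ) :
    ApplicableHist I C (α ++ ρ) ∧ ApplicableHist I C (ρ ++ α) ∧
      applyHist I C (α ++ ρ) = applyHist I C (ρ ++ α) ∧
      ∀ ev, ev ∈ runEvents I C (α ++ ρ) ↔ ev ∈ runEvents I C (ρ ++ α) := by
  induction α generalizing C with
  | nil => simp [hρ]
  | cons e α ih =>
    have hne : ∀ x ∈ ρ, x.1 ≠ e.1 := fun x hx => h x hx e (by simp)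
    obtain ⟨h1, h2, h3, h4⟩ := step_hist_comm hne hα.1 hρ
    obtain ⟨i1, i2, i3, i4⟩ := ih (fun x hx y hy => h x hx y (by simp [hy])) hα.2 h1
    refine ⟨⟨hα.1, i1⟩, ?_, ?_, ?_⟩
    · rw [applicableHist_append] at i2 ⊢
      refine ⟨hρ, hα.1.applyHist fun hm => hne e hm rfl, h2 ▸ i2.2⟩
    · rw [applyHist_append C ρ]
      exact i3.trans (by rw [applyHist_append, h2]; rfl)
    · intro ev
      have := i4 ev
      rw [runEvents_append] at this ⊢
      simp only [runEvents_append, List.mem_append, runEvents, h2, h3, h4]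
        at this ⊢
      tauto

/-- Histories that lead to the same configuration and have the same events. -/
def Indist (G₁ G₂ : List (Step n I.Msg)) : Prop :=
  applyHist I (initConfig I) G₁ = applyHist I (initConfig I) G₂ ∧
    ∀ ev, ev ∈ events I G₁ ↔ ev ∈ events I G₂

theorem Indist.append {G₁ G₂ : List (Step n I.Msg)} (h : Indist G₁ G₂)
    (ρ : List (Step n I.Msg)) : Indist (G₁ ++ ρ) (G₂ ++ ρ) := by
  refine ⟨by rw [applyHist_append, applyHist_append, h.1], fun ev => ?_⟩
  rw [events_append, events_append, List.mem_append, List.mem_append, h.1, h.2]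

theorem indist_of_disjoint {G α ρ : List (Step n I.Msg)}
    (h : ∀ x ∈ ρ, ∀ y ∈ α, x.1 ≠ y.1) (hα : G ++ α ∈ Histories I)
    (hρ : G ++ ρ ∈ Histories I) :
    G ++ α ++ ρ ∈ Histories I ∧ G ++ ρ ++ α ∈ Histories I ∧
      Indist (G ++ α ++ ρ) (G ++ ρ ++ α) := by
  rw [mem_histories_append] at hα hρ
  obtain ⟨h1, h2, h3, h4⟩ := hist_hist_comm h hα.2 hρ.2
  simp only [List.append_assoc, mem_histories_append, Indist]
  refine ⟨⟨hα.1, h1⟩, ⟨hα.1, h2⟩, ?_, fun ev => ?_⟩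
  · rw [applyHist_append, h3, ← applyHist_append]
  · rw [events_append, events_append, List.mem_append, List.mem_append, h4]

/-! ### Fair schedules -/

theorem prefixSteps_add {β : Type*} (S : ℕ → β) (k l : ℕ) :
    prefixSteps S (k + l) = prefixSteps S k ++ prefixSteps (fun i => S (k + i)) l := by
  simp [prefixSteps, List.range_add, Function.comp_def]

theorem prefixSteps_isPrefix {β : Type*} (S : ℕ → β) {k l : ℕ} (h : k ≤ l) :
    prefixSteps S k <+: prefixSteps S l := by
  obtain ⟨d, rfl⟩ := Nat.exists_eq_add_of_le h
  exact ⟨_, (prefixSteps_add S k d).symm⟩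

theorem mem_prefixSteps {β : Type*} {S : ℕ → β} {k : ℕ} {x : β} :
    x ∈ prefixSteps S k ↔ ∃ i < k, S i = x := by
  simp [prefixSteps]

/-- A growing sequence of lists converges to an infinite sequence. -/
theorem exists_limit_of_isPrefix {β : Type*} (H : ℕ → List β) (hlen : ∀ i, i ≤ (H i).length)
    (hpre : ∀ i, H i <+: H (i + 1)) :
    ∃ S : ℕ → β, ∀ i, prefixSteps S (H i).length = H i := by
  have hmono : ∀ i j, i ≤ j → H i <+: H j := fun i j hij =>
    Nat.le_induction (List.prefix_refl _) (fun j _ ih => ih.trans (hpre j)) j hij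
  refine ⟨fun k => (H (k + 1))[k]'(hlen (k + 1)), fun i => ?_⟩
  refine List.ext_getElem (by simp [prefixSteps]) fun k h1 h2 => ?_
  simp only [prefixSteps, List.getElem_map, List.getElem_range]
  rcases le_total i (k + 1) with h | h
  · exact ((hmono _ _ h).getElem h2).symm
  · exact (hmono _ _ h).getElem _

/-- If every applicable step of an allowed process can be appended, possibly after some
detour, while preserving `P`, then all of finitely many applicable steps can. -/
theorem exists_round {C : Config I} {A : Fin n → Prop} {P : List (Step n I.Msg) → Prop}
    (hext : ∀ H, ApplicableHist I C H → P H → ∀ e : Step n I.Msg, A e.1 →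
      Applicable I (applyHist I C H) e →
      ∃ σ, (∀ x ∈ σ, A x.1) ∧ ApplicableHist I C (H ++ σ ++ [e]) ∧ P (H ++ σ ++ [e]))
    {H : List (Step n I.Msg)} (hH : ApplicableHist I C H) (hP : P H)
    (L : List (Step n I.Msg)) (hL : ∀ e ∈ L, A e.1 ∧ Applicable I (applyHist I C H) e) :
    ∃ τ, (∀ x ∈ τ, A x.1) ∧ ApplicableHist I C (H ++ τ) ∧ P (H ++ τ) ∧ ∀ e ∈ L, e ∈ τ := by
  induction L with
  | nil => exact ⟨[], by simp, by simpa using hH, by simpa using hP, by simp⟩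
  | cons e L ih =>
    obtain ⟨τ, h1, h2, h3, h4⟩ := ih fun x hx => hL x (by simp [hx])
    by_cases hm : e ∈ τ
    · exact ⟨τ, h1, h2, h3, by simpa [hm] using h4⟩
    · obtain ⟨hA, happ⟩ := hL e (by simp)
      obtain ⟨σ, s1, s2, s3⟩ := hext _ h2 h3 e hA
        (by rw [applyHist_append]; exact happ.applyHist hm)
      refine ⟨τ ++ σ ++ [e], ?_, by simpa using s2, by simpa using s3, ?_⟩
      · simp only [List.mem_append, List.mem_singleton]
        rintro x ((hx | hx) | rfl)
        exacts [h1 x hx, s1 x hx, hA]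
      · simp only [List.mem_cons, List.mem_append, List.not_mem_nil, or_false]
        rintro x (rfl | hx)
        exacts [.inr rfl, .inl (.inl (h4 x hx))]

theorem exists_fair_schedule {C : Config I} {A : Fin n → Prop}
    {P : List (Step n I.Msg) → Prop} (hA : ∃ p, A p) (hP : P [])
    (hext : ∀ H, ApplicableHist I C H → P H → ∀ e : Step n I.Msg, A e.1 →
      Applicable I (applyHist I C H) e →
      ∃ σ, (∀ x ∈ σ, A x.1) ∧ ApplicableHist I C (H ++ σ ++ [e]) ∧ P (H ++ σ ++ [e])) :
    ∃ S : ℕ → Step n I.Msg, InfApplicable I C S ∧ (∀ k, A (S k).1) ∧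
      (∀ p, A p → CorrectProc p S) ∧ FairDelivery I C S ∧
      ∀ k, ∃ k' ≥ k, P (prefixSteps S k') := by
  classical
  have hround : ∀ H : {H : List (Step n I.Msg) //
      ApplicableHist I C H ∧ P H ∧ ∀ x ∈ H, A x.1},
      ∃ τ, (∀ x ∈ τ, A x.1) ∧ ApplicableHist I C (H.1 ++ τ) ∧ P (H.1 ++ τ) ∧
        (∀ p, A p → (p, none) ∈ τ) ∧
        ∀ p m, A p → (p, m) ∈ (applyHist I C H.1).buffer → (p, some m) ∈ τ := by
    rintro ⟨H, h1, h2, -⟩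
    obtain ⟨τ, t1, t2, t3, t4⟩ := exists_round hext h1 h2
      (((List.finRange n).filter (A ·)).map (·, none) ++
        ((applyHist I C H).buffer.toList.filter (A ·.1)).map fun x => (x.1, some x.2)) (by
        simp only [List.mem_append, List.mem_map, List.mem_filter, decide_eq_true_eq,
          Multiset.mem_toList]
        rintro e (⟨p, ⟨-, hp⟩, rfl⟩ | ⟨x, ⟨hx, hp⟩, rfl⟩)
        exacts [⟨hp, trivial⟩, ⟨hp, hx⟩])
    refine ⟨τ, t1, t2, t3, fun p hp => t4 _ ?_, fun p m hp hm => t4 _ ?_⟩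
    · exact List.mem_append_left _ (List.mem_map.2 ⟨p, by simp [hp], rfl⟩)
    · exact List.mem_append_right _ (List.mem_map.2 ⟨(p, m), by simp [hp, hm], rfl⟩)
  choose τ t1 t2 t3 t4 t5 using hround
  let R : ℕ → {H : List (Step n I.Msg) // ApplicableHist I C H ∧ P H ∧ ∀ x ∈ H, A x.1} :=
    fun i => Nat.rec ⟨[], trivial, hP, by simp⟩
      (fun _ H => ⟨H.1 ++ τ H, t2 H, t3 H, by
        simp only [List.mem_append]
        rintro x (hx | hx)
        exacts [H.2.2.2 x hx, t1 H x hx]⟩) i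
  have hsucc : ∀ i, (R (i + 1)).1 = (R i).1 ++ τ (R i) := fun i => rfl
  have hlen : ∀ i, i ≤ (R i).1.length := fun i => by
    induction i with
    | zero => simp
    | succ i ih =>
      obtain ⟨p, hp⟩ := hA
      have := List.length_pos_of_mem (t4 (R i) p hp)
      rw [hsucc, List.length_append]
      omega
  obtain ⟨S, hS⟩ := exists_limit_of_isPrefix (fun i => (R i).1) hlen
    fun i => ⟨_, (hsucc i).symm⟩
  have hpre : ∀ k, prefixSteps S k <+: (R k).1 := fun k => by
    rw [← hS k]
    exact prefixSteps_isPrefix S (hlen k)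
  have hSA : ∀ k, A (S k).1 := fun k =>
    (R (k + 1)).2.2.2 _ ((hpre (k + 1)).subset (mem_prefixSteps.2 ⟨k, by omega, rfl⟩))
  have htail : ∀ i, ∀ x ∈ τ (R i), ∃ k ≥ (R i).1.length, S k = x := fun i x hx => by
    have h := hS (i + 1)
    simp only [hsucc] at h
    rw [List.length_append, prefixSteps_add, hS i, List.append_cancel_left_eq] at h
    rw [← h, mem_prefixSteps] at hx
    obtain ⟨j, -, hj⟩ := hx
    exact ⟨_, Nat.le_add_right _ _, hj⟩
  refine ⟨S, fun k => ?_, hSA, fun p hp k => ?_, fun k p m hp hm => ?_, fun k => ?_⟩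
  · obtain ⟨ρ, hρ⟩ := hpre (k + 1)
    have h := (R (k + 1)).2.1
    rw [← hρ, prefixSteps_add, applicableHist_append, applicableHist_append] at h
    exact h.1.2.1
  · obtain ⟨k', hk', h⟩ := htail k _ (t4 (R k) p hp)
    exact ⟨k', (hlen k).trans hk', by rw [h]⟩
  · have hAp : A p := by
      obtain ⟨k', -, h⟩ := hp 0
      exact h ▸ hSA k'
    obtain ⟨d, hd⟩ := Nat.exists_eq_add_of_le (hlen k)
    have hR := hS k
    simp only [hd] at hR
    rw [prefixSteps_add] at hR
    by_cases hmem : (p, some m) ∈ prefixSteps (fun i => S (k + i)) d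
    · obtain ⟨j, -, hj⟩ := mem_prefixSteps.1 hmem
      exact ⟨k + j, Nat.le_add_right _ _, hj⟩
    · have hb : Applicable I (applyHist I C (R k).1) (p, some m) := by
        rw [← hR, applyHist_append]
        exact Applicable.applyHist (e := (p, some m)) hm hmem
      obtain ⟨k', hk', h⟩ := htail k _ (t5 (R k) p m hAp hb)
      exact ⟨k', (hlen k).trans hk', h⟩
  · exact ⟨_, hlen k, by rw [hS]; exact (R k).2.2.1⟩

/-- From a history with a pending operation, the processes in `A` (all but at most one)
can complete an operation on their own. -/
theorem OneResilientLockFree.exists_completed (hLF : OneResilientLockFree I)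
    {A : Fin n → Prop} (hA : ∀ p q, ¬ A p → ¬ A q → p = q)
    {H : List (Step n I.Msg)} (hH : H ∈ Histories I) {o : Op} (ho : Pending o (events I H))
    (hAo : A (I.procOf o)) :
    ∃ τ, (∀ x ∈ τ, A x.1) ∧ H ++ τ ∈ Histories I ∧
      ∃ o', Completed o' (events I (H ++ τ)) ∧ ¬ Completed o' (events I H) := by
  obtain ⟨S, s1, s2, s3, s4, s5⟩ := exists_fair_schedule
    (C := applyHist I (initConfig I) H) (A := A)
    (P := fun τ => ApplicableHist I (applyHist I (initConfig I) H) τ) ⟨_, hAo⟩ trivial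
    (fun τ hτ _ e _ happ => by
      have : ApplicableHist I (applyHist I (initConfig I) H) (τ ++ [] ++ [e]) := by
        rw [List.append_nil, applicableHist_append, applicableHist_singleton]
        exact ⟨hτ, happ⟩
      exact ⟨[], by simp, this, this⟩)
  obtain ⟨k, o', hc, hnc⟩ := hLF H hH _ o rfl ho S s1
    (fun p q hp hq => hA p q (mt (s3 p) hp) (mt (s3 q) hq)) (s3 _ hAo) s4
  refine ⟨prefixSteps S k, fun x hx => ?_, ?_, o', hc, hnc⟩
  · obtain ⟨i, -, rfl⟩ := mem_prefixSteps.1 hx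
    exact s2 i
  · obtain ⟨k', hk', h⟩ := s5 k
    obtain ⟨ρ, hρ⟩ := prefixSteps_isPrefix S hk'
    rw [← hρ, applicableHist_append] at h
    exact (mem_histories_append _ _).2 ⟨hH, h.1⟩

/-! ### Linearizations -/

theorem IsLinearizationFn.inv_mem_events {Spec : List (Event Op Val) → Prop}
    {f : List (Step n I.Msg) → List (Event Op Val)} (hf : IsLinearizationFn I Spec f)
    {H : List (Step n I.Msg)} (hH : H ∈ Histories I) {o : Op} (h : Event.inv o ∈ f H) :
    Event.inv o ∈ events I H := by
  obtain ⟨-, ⟨L', ⟨removed, R, -, hR, -, -, rfl⟩, hmem, -⟩, -⟩ := hf H hH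
  rcases List.mem_append.1 ((hmem _).1 h) with h | h
  · exact (List.mem_filter.1 h).1
  · obtain ⟨o', v, heq, -⟩ := hR _ h
    simp at heq

theorem IsLinearizationFn.res_mem {Spec : List (Event Op Val) → Prop}
    {f : List (Step n I.Msg) → List (Event Op Val)} (hf : IsLinearizationFn I Spec f)
    {H : List (Step n I.Msg)} (hH : H ∈ Histories I) {o : Op} {v : Val}
    (h : Event.res o v ∈ events I H) (w : Val) :
    Event.res o w ∈ f H ↔ Event.res o w ∈ events I H := by
  obtain ⟨-, ⟨L', ⟨removed, R, hrem, hR, -, -, rfl⟩, hmem, -⟩, -⟩ := hf H hH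
  rw [hmem, List.mem_append, List.mem_filter]
  constructor
  · rintro (h' | h')
    · exact h'.1
    · obtain ⟨o', v', heq, hp, -⟩ := hR _ h'
      obtain ⟨rfl, rfl⟩ := Event.res.inj heq
      exact absurd h (hp.2 v)
  · refine fun h' => .inl ⟨h', ?_⟩
    cases hr : removed o with
    | false => simp [Event.opOf, hr]
    | true => exact absurd h ((hrem o hr).2 v)

/-- The first operation of the linearization of `H` is `o`. -/
def LinFirst (f : List (Step n I.Msg) → List (Event Op Val)) (o : Op)
    (H : List (Step n I.Msg)) : Prop :=
  ∃ L, f H = Event.inv o :: L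

theorem LinFirst.unique {f : List (Step n I.Msg) → List (Event Op Val)} {o o' : Op}
    {H : List (Step n I.Msg)} (h : LinFirst f o H) (h' : LinFirst f o' H) : o = o' := by
  obtain ⟨L, hL⟩ := h
  obtain ⟨L', hL'⟩ := h'
  simpa using congrArg List.head? (hL.symm.trans hL')

theorem LinFirst.of_isPrefix {f : List (Step n I.Msg) → List (Event Op Val)} {o : Op}
    {G H : List (Step n I.Msg)} (h : LinFirst f o G) (hp : f G <+: f H) : LinFirst f o H := by
  obtain ⟨L, hL⟩ := h
  obtain ⟨ρ, hρ⟩ := hp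
  exact ⟨L ++ ρ, by rw [← hρ, hL, List.cons_append]⟩

theorem IsLinearizationFn.exists_linFirst {Spec : List (Event Op Val) → Prop}
    {f : List (Step n I.Msg) → List (Event Op Val)} (hf : IsLinearizationFn I Spec f)
    {H : List (Step n I.Msg)} (hH : H ∈ Histories I) {o : Op}
    (h : Completed o (events I H)) : ∃ o', LinFirst f o' H := by
  obtain ⟨-, v, hv⟩ := h
  have hmem := (hf.res_mem hH hv v).2 hv
  have hseq := (hf H hH).1
  rcases hfH : f H with _ | ⟨⟨o'⟩ | ⟨o', w⟩, L⟩
  · simp [hfH] at hmem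
  · exact ⟨o', L, hfH⟩
  · simp [hfH, Sequential] at hseq

end Runs

section Counter

variable {n : ℕ} {I : Impl n CtrOp ℕ} {p0 p1 : Fin n}
  {f : List (Step n I.Msg) → List (Event CtrOp ℕ)}

/-- The value returned by a completed read tells which operation is linearized first. -/
theorem linFirst_read_iff (hf : IsLinearizationFn I CtrSpec f) (hwf : WellFormed I)
    {H : List (Step n I.Msg)} (hH : H ∈ Histories I) {w : ℕ}
    (h : Event.res CtrOp.read w ∈ events I H) : LinFirst f CtrOp.read H ↔ w = 0 := by
  obtain ⟨hseq, -, hspec⟩ := hf H hH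
  have hmem := (hf.res_mem hH h w).2 h
  constructor
  · rintro ⟨L, hL⟩
    rw [hL] at hseq hspec hmem
    rcases L with _ | ⟨⟨o⟩ | ⟨o, v⟩, L⟩
    · simp at hmem
    · simp [Sequential] at hseq
    · obtain ⟨rfl, -⟩ := hseq
      have hv : v = 0 := by simpa using hspec 1 (by simp) v rfl
      have hv' := (hf.res_mem hH h v).1 (by simp [hL])
      obtain ⟨i, hi, hiw⟩ := List.getElem_of_mem h
      obtain ⟨j, hj, hjv⟩ := List.getElem_of_mem hv'
      obtain rfl := (hwf H hH).2.1 CtrOp.read i j hi hj w v hiw hjv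
      rw [← hv]
      exact (Event.res.inj (hiw.symm.trans hjv)).2
  · rintro rfl
    obtain ⟨o, L, hL⟩ := hf.exists_linFirst hH ⟨(hwf H hH).2.2 _ _ h, 0, h⟩
    cases o with
    | read => exact ⟨L, hL⟩
    | inc =>
      obtain ⟨i, hi, hi0⟩ := List.getElem_of_mem hmem
      have hc := hspec i hi 0 hi0
      rcases i with _ | i
      · simp [hL] at hi0
      · simp [hL] at hc

theorem mem_runEvents_own (hI : CtrAlg I p0 p1) {C : Config I} {H : List (Step n I.Msg)}
    {ev : Event CtrOp ℕ} (h : ev ∈ runEvents I C H) : ∃ x ∈ H, x.1 = I.procOf ev.opOf := by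
  induction H generalizing C with
  | nil => simp [runEvents] at h
  | cons e H ih =>
    rcases List.mem_append.1 h with h | h
    · exact ⟨e, by simp, (hI.events_own _ _ _ _ (by simpa [stepEvent] using h)).symm⟩
    · obtain ⟨x, hx, hp⟩ := ih h
      exact ⟨x, by simp [hx], hp⟩

theorem CtrAlg.invokes (hI : CtrAlg I p0 p1) (o : CtrOp) (m : Option I.Msg) :
    I.eventOf (I.procOf o) (I.init (I.procOf o))
      (I.trans (I.procOf o) (I.init (I.procOf o)) m).1 = some (Event.inv o) := by
  cases o with
  | inc => rw [hI.proc_inc]; exact hI.invokes_inc m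
  | read => rw [hI.proc_read]; exact hI.invokes_read m

theorem CtrAlg.init_or_invoked (hI : CtrAlg I p0 p1) (o : CtrOp) (H : List (Step n I.Msg)) :
    (applyHist I (initConfig I) H).states (I.procOf o) = I.init (I.procOf o) ∨
      Event.inv o ∈ events I H := by
  induction H using List.reverseRecOn with
  | nil => exact .inl rfl
  | append_singleton H e ih =>
    rcases ih with ih | ih
    · obtain ⟨p, m⟩ := e
      by_cases hp : I.procOf o = p
      · subst hp
        right
        rw [events_append]
        refine List.mem_append_right _ ?_
        simp [runEvents, stepEvent, applyStep, ih, hI.invokes o m]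
      · left
        rw [applyHist_append]
        exact (applyStep_states_of_ne _ hp).trans ih
    · exact .inr (mem_events_append_left _ ih)

theorem CtrAlg.invoked_of_step (hI : CtrAlg I p0 p1) (o : CtrOp) (H : List (Step n I.Msg))
    (m : Option I.Msg) : Event.inv o ∈ events I (H ++ [(I.procOf o, m)]) := by
  rcases hI.init_or_invoked o H with h | h
  · rw [events_append]
    refine List.mem_append_right _ ?_
    simp [runEvents, stepEvent, applyStep, h, hI.invokes o m]
  · exact mem_events_append_left _ h

theorem mem_histories_append_none {H : List (Step n I.Msg)} (hH : H ∈ Histories I)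
    (p : Fin n) : H ++ [(p, none)] ∈ Histories I :=
  (mem_histories_append _ _).2 ⟨hH, trivial, trivial⟩

/-- The processes in `A` (all but at most one) can force some operation to complete. -/
theorem CtrAlg.exists_extension_completed (hI : CtrAlg I p0 p1) (hLF : OneResilientLockFree I)
    {A : Fin n → Prop} (hA : ∀ p q, ¬ A p → ¬ A q → p = q)
    {H : List (Step n I.Msg)} (hH : H ∈ Histories I) :
    ∃ τ, (∀ x ∈ τ, A x.1) ∧ H ++ τ ∈ Histories I ∧ ∃ o, Completed o (events I (H ++ τ)) := by
  obtain ⟨o, ho⟩ : ∃ o, A (I.procOf o) := by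
    by_contra! hno
    have h := hA _ _ (hno CtrOp.read) (hno CtrOp.inc)
    rw [hI.proc_read, hI.proc_inc] at h
    exact hI.distinct h
  have hH' := mem_histories_append_none hH (I.procOf o)
  rcases pending_or_completed (hI.invoked_of_step o H none) with hp | hc
  · obtain ⟨τ, t1, t2, o', t3, -⟩ := hLF.exists_completed hA hH' hp ho
    refine ⟨(I.procOf o, none) :: τ, ?_, by simpa using t2, o', by simpa using t3⟩
    simpa [ho] using fun a b h => t1 (a, b) h
  · exact ⟨_, by simpa using ho, hH', o, hc⟩

theorem CtrAlg.exists_extension_read (hI : CtrAlg I p0 p1) (hLF : OneResilientLockFree I)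
    {H : List (Step n I.Msg)} (hH : H ∈ Histories I) :
    ∃ τ, H ++ τ ∈ Histories I ∧ Completed CtrOp.read (events I (H ++ τ)) := by
  have hA : ∀ p q : Fin n, ¬ True → ¬ True → p = q := fun _ _ h => absurd trivial h
  have hH' := mem_histories_append_none hH (I.procOf CtrOp.read)
  have hinv := hI.invoked_of_step CtrOp.read H none
  rcases pending_or_completed hinv with hp | hc
  swap
  · exact ⟨_, hH', hc⟩
  obtain ⟨τ, -, t2, o, t3, -⟩ := hLF.exists_completed hA hH' hp trivial
  rcases pending_or_completed (mem_events_append_left τ hinv) with hp' | hc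
  swap
  · exact ⟨(I.procOf CtrOp.read, none) :: τ, by simpa using t2, by simpa using hc⟩
  obtain ⟨τ', -, s2, o', s3, s4⟩ := hLF.exists_completed hA t2 hp' trivial
  refine ⟨(I.procOf CtrOp.read, none) :: (τ ++ τ'), by simpa using s2, ?_⟩
  have ho : o = CtrOp.inc := by
    cases o with
    | inc => rfl
    | read => exact absurd t3.2.choose_spec (hp'.2 _)
  have ho' : o' = CtrOp.read := by
    cases o' with
    | inc => exact absurd (ho ▸ t3) s4
    | read => rfl
  simpa [ho'] using s3

/-- `H` can be extended to a history whose linearization starts with `o`. -/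
def CanLinFirst (f : List (Step n I.Msg) → List (Event CtrOp ℕ)) (o : CtrOp)
    (H : List (Step n I.Msg)) : Prop :=
  ∃ ρ, H ++ ρ ∈ Histories I ∧ LinFirst f o (H ++ ρ)

/-- Both operations can still be linearized first. -/
def Bivalent (f : List (Step n I.Msg) → List (Event CtrOp ℕ)) (H : List (Step n I.Msg)) :
    Prop :=
  ∀ o, CanLinFirst f o H

theorem CanLinFirst.of_append {o : CtrOp} {H ρ : List (Step n I.Msg)}
    (h : CanLinFirst f o (H ++ ρ)) : CanLinFirst f o H := by
  obtain ⟨τ, h1, h2⟩ := h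
  exact ⟨ρ ++ τ, by simpa using h1, by simpa using h2⟩

theorem CanLinFirst.eq_of_linFirst
    (hpre : ∀ G H, G ∈ Histories I → H ∈ Histories I → G <+: H → f G <+: f H)
    {o o' : CtrOp} {H : List (Step n I.Msg)} (h : CanLinFirst f o H)
    (h' : LinFirst f o' H) : o = o' := by
  obtain ⟨ρ, h1, h2⟩ := h
  have hp : H <+: H ++ ρ := List.prefix_append _ _
  exact h2.unique (h'.of_isPrefix (hpre _ _ (mem_histories_of_isPrefix hp h1) h1 hp))

theorem exists_canLinFirst_of_indist (hI : CtrAlg I p0 p1) (hLF : OneResilientLockFree I)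
    (hf : IsLinearizationFn I CtrSpec f) {G₁ G₂ : List (Step n I.Msg)}
    (h₁ : G₁ ∈ Histories I) (h₂ : G₂ ∈ Histories I) (h : Indist G₁ G₂) :
    ∃ o, CanLinFirst f o G₁ ∧ CanLinFirst f o G₂ := by
  obtain ⟨ρ, r1, r2⟩ := hI.exists_extension_read hLF h₁
  have r1' : G₂ ++ ρ ∈ Histories I := by
    rw [mem_histories_append] at r1 ⊢
    exact ⟨h₂, h.1 ▸ r1.2⟩
  obtain ⟨w, hw⟩ := r2.2
  have hw' := ((h.append ρ).2 _).1 hw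
  have e1 := linFirst_read_iff hf hI.wellFormed r1 hw
  have e2 := linFirst_read_iff hf hI.wellFormed r1' hw'
  obtain ⟨o, ho⟩ := hf.exists_linFirst r1 r2
  obtain ⟨o', ho'⟩ := hf.exists_linFirst r1' ⟨((h.append ρ).2 _).1 r2.1, w, hw'⟩
  have hoo : o = o' := by
    cases o <;> cases o'
    · rfl
    · exact ho.unique (e1.2 (e2.1 ho'))
    · exact (ho'.unique (e2.2 (e1.1 ho))).symm
    · rfl
  exact ⟨o, ⟨ρ, r1, ho⟩, ⟨ρ, r1', hoo ▸ ho'⟩⟩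

/-- The Fischer–Lynch–Paterson step: any applicable step can be taken, possibly after
some others, while preserving bivalence. -/
theorem Bivalent.exists_extension (hI : CtrAlg I p0 p1) (hLF : OneResilientLockFree I)
    (hf : IsLinearizationFn I CtrSpec f)
    (hpre : ∀ G H, G ∈ Histories I → H ∈ Histories I → G <+: H → f G <+: f H)
    {H : List (Step n I.Msg)} (hH : H ∈ Histories I) (hb : Bivalent f H)
    {e : Step n I.Msg} (he : Applicable I (applyHist I (initConfig I) H) e) :
    ∃ σ, H ++ σ ++ [e] ∈ Histories I ∧ Bivalent f (H ++ σ ++ [e]) := by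
  by_contra! hno
  have happ : ∀ σ, H ++ σ ∈ Histories I → e ∉ σ → H ++ σ ++ [e] ∈ Histories I :=
    fun σ hσ hne => by
      rw [mem_histories_append, applicableHist_singleton, applyHist_append]
      exact ⟨hσ, he.applyHist hne⟩
  have huniq : ∀ σ, H ++ σ ++ [e] ∈ Histories I → ∀ o o', CanLinFirst f o (H ++ σ ++ [e]) →
      CanLinFirst f o' (H ++ σ ++ [e]) → o = o' := fun σ hσ o o' h h' => by
    by_contra hoo
    refine hno σ hσ fun u => ?_
    cases o <;> cases o' <;> cases u <;> first | exact h | exact h' | exact absurd rfl hoo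
  have hreach : ∀ o, ∃ σ, H ++ σ ∈ Histories I ∧ e ∉ σ ∧
      CanLinFirst f o (H ++ σ ++ [e]) := fun o => by
    obtain ⟨τ, t1, t2⟩ := hb o
    by_cases hm : e ∈ τ
    · obtain ⟨σ, ρ, rfl, hne⟩ := List.eq_append_cons_of_mem hm
      refine ⟨σ, mem_histories_of_isPrefix ⟨e :: ρ, by simp⟩ t1, hne, ρ, ?_, ?_⟩
      · simpa using t1
      · simpa using t2
    · have h := happ τ t1 hm
      refine ⟨τ, t1, hm, [], by simpa using h, ?_⟩
      rw [List.append_nil]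
      exact t2.of_isPrefix (hpre _ _ t1 h (List.prefix_append _ _))
  have hHe := happ [] (by simpa using hH) (by simp)
  obtain ⟨v, hv, -⟩ := exists_canLinFirst_of_indist hI hLF hf hHe hHe ⟨rfl, fun _ => .rfl⟩
  have hall : ∀ σ, H ++ σ ∈ Histories I → e ∉ σ → CanLinFirst f v (H ++ σ ++ [e]) := by
    intro σ
    induction σ using List.reverseRecOn with
    | nil => exact fun _ _ => hv
    | append_singleton σ e' ih =>
      intro hσ hne
      simp only [List.mem_append, List.mem_singleton, not_or] at hne
      have hσe' : H ++ σ ++ [e'] ∈ Histories I := by simpa using hσ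
      have hG := mem_histories_of_isPrefix (List.prefix_append _ _) hσe'
      have hGe := happ σ hG hne.1
      have hGe'e : H ++ σ ++ [e', e] ∈ Histories I := by
        simpa using happ (σ ++ [e']) hσ (by simpa using hne)
      have ihv := ih hG hne.1
      suffices h : CanLinFirst f v (H ++ σ ++ [e', e]) by simpa using h
      by_cases hp : e'.1 = e.1
      · obtain ⟨ρ, r1, r2, o, r3⟩ := hI.exists_extension_completed hLF
          (A := fun p => p ≠ e.1) (fun p q h h' => (not_not.1 h).trans (not_not.1 h').symm) hG
        obtain ⟨u, hu⟩ := hf.exists_linFirst r2 r3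
        obtain ⟨a1, a2, a3⟩ := indist_of_disjoint (α := [e])
          (by simpa using fun a b h => r1 (a, b) h) hGe r2
        obtain ⟨b1, b2, b3⟩ := indist_of_disjoint (α := [e', e])
          (by simpa [hp] using fun a b h => r1 (a, b) h) hGe'e r2
        obtain ⟨x, x1, x2⟩ := exists_canLinFirst_of_indist hI hLF hf a1 a2 a3
        obtain ⟨y, y1, y2⟩ := exists_canLinFirst_of_indist hI hLF hf b1 b2 b3
        have hxu := x2.of_append.eq_of_linFirst hpre hu
        have hyu := y2.of_append.eq_of_linFirst hpre hu
        have hxv := huniq σ hGe x v x1.of_append ihv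
        rw [← hxv, hxu, ← hyu]
        exact y1.of_append
      · obtain ⟨a1, a2, a3⟩ := indist_of_disjoint (α := [e]) (ρ := [e'])
          (by simpa using hp) hGe hσe'
        obtain ⟨x, x1, x2⟩ := exists_canLinFirst_of_indist hI hLF hf a1 a2 a3
        rw [← huniq σ hGe x v x1.of_append ihv]
        simpa using x2
  have heq : ∀ o, o = v := fun o => by
    obtain ⟨σ, s1, s2, s3⟩ := hreach o
    exact huniq σ (happ σ s1 s2) o v s3 (hall σ s1 s2)
  exact CtrOp.noConfusion ((heq CtrOp.inc).trans (heq CtrOp.read).symm)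

theorem bivalent_nil (hI : CtrAlg I p0 p1) (hLF : OneResilientLockFree I)
    (hf : IsLinearizationFn I CtrSpec f) : Bivalent f [] := by
  have key : ∀ o o', o ≠ o' → CanLinFirst f o [] := fun o o' hoo => by
    obtain ⟨τ, t1, t2, o₁, t3⟩ := hI.exists_extension_completed hLF
      (A := fun p => p ≠ I.procOf o') (fun p q h h' => (not_not.1 h).trans (not_not.1 h').symm)
      (H := []) trivial
    obtain ⟨u, hu⟩ := hf.exists_linFirst t2 t3
    have hinv : Event.inv u ∈ events I ([] ++ τ) := by
      obtain ⟨L, hL⟩ := hu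
      exact hf.inv_mem_events t2 (by rw [hL]; exact List.mem_cons_self)
    obtain ⟨x, hx, hxu⟩ := mem_runEvents_own hI hinv
    have huo : u ≠ o' := fun h => t1 x hx (by rw [hxu, ← h]; rfl)
    have : u = o := by
      cases o <;> cases o' <;> cases u <;> simp_all
    exact ⟨τ, t2, this ▸ hu⟩
  intro o
  cases o with
  | inc => exact key _ CtrOp.read (by simp)
  | read => exact key _ CtrOp.inc (by simp)

theorem Bivalent.not_completed (hf : IsLinearizationFn I CtrSpec f)
    (hpre : ∀ G H, G ∈ Histories I → H ∈ Histories I → G <+: H → f G <+: f H)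
    {H : List (Step n I.Msg)} (hH : H ∈ Histories I) (hb : Bivalent f H) (o : CtrOp) :
    ¬ Completed o (events I H) := fun hc => by
  obtain ⟨u, hu⟩ := hf.exists_linFirst hH hc
  have h1 := (hb CtrOp.inc).eq_of_linFirst hpre hu
  have h2 := (hb CtrOp.read).eq_of_linFirst hpre hu
  exact CtrOp.noConfusion (h1.trans h2.symm)

end Counter

/-- **Corollary (counters).** For all `n ≥ 2`, there is no 1-resilient lock-free
strongly linearizable implementation of a counter in an asynchronous message-passing
system of `n` processes. -/
theorem no_oneResilient_lockFree_stronglyLinearizable_counter (n : ℕ) (hn : 2 ≤ n) :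
    ¬ ∃ (I : Impl n CtrOp ℕ) (p0 p1 : Fin n),
        CtrAlg I p0 p1 ∧ OneResilientLockFree I ∧ StronglyLinearizable I CtrSpec := by
  rintro ⟨I, p0, p1, hI, hLF, f, hf, hpre⟩
  obtain ⟨σ, hH, hb⟩ := (bivalent_nil hI hLF hf).exists_extension hI hLF hf hpre
    (H := []) trivial (e := (I.procOf CtrOp.read, none)) trivial
  have hinv := hI.invoked_of_step CtrOp.read ([] ++ σ) none
  generalize [] ++ σ ++ [(I.procOf CtrOp.read, none)] = H at hH hb hinv
  have hpend : Pending CtrOp.read (events I H) :=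
    (pending_or_completed hinv).resolve_right (hb.not_completed hf hpre hH _)
  obtain ⟨S, s1, -, s3, s4, s5⟩ := exists_fair_schedule
    (C := applyHist I (initConfig I) H) (A := fun _ => True)
    (P := fun τ => H ++ τ ∈ Histories I ∧ Bivalent f (H ++ τ)) ⟨p0, trivial⟩
    (by simpa using ⟨hH, hb⟩) (fun τ _ hP e _ happ => by
      rw [← applyHist_append] at happ
      obtain ⟨ρ, r1, r2⟩ := hP.2.exists_extension hI hLF hf hpre hP.1 happ
      simp only [List.append_assoc] at r1 r2 ⊢
      refine ⟨ρ, by simp, ((mem_histories_append _ _).1 r1).2, r1, r2⟩)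
  obtain ⟨k, o, hc, -⟩ := hLF H hH _ CtrOp.read rfl hpend S s1
    (fun p q hp => absurd (s3 p trivial) hp) (s3 _ trivial) s4
  obtain ⟨k', hk', hk1, hk2⟩ := s5 k
  obtain ⟨ρ, hρ⟩ := prefixSteps_isPrefix S hk'
  refine hk2.not_completed hf hpre hk1 o ?_
  rw [← hρ, ← List.append_assoc]
  exact hc.append ρ

end MP
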